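/- Let k ≥ 1 and t > 0. Then the graded maps H_{m,t} := Σ_{i=1}^{m+1} (−1)^{i+1} η_{m,i,t} form a homotopy between the identity and the localization operator: for every function f : (ℝ^n)^{k+1} → ℝ one has, pointwise on (ℝ^n)^{k+1}, b(H_{k,t} f) + H_{k−1,t}(b f) = f − Ψ_{k,t}·f. -/

import Mathlib

open scoped BigOperators
open MeasureTheory

noncomputable section

abbrev Euc (n : ℕ) : Type := EuclideanSpace ℝ (Fin n)

/-- The `i`-th simplicial face map `D_i : E^k → E^{k+1}`. -/
def face {n : ℕ} (k i : ℕ) (x : Fin k → Euc n) : Fin (k + 1) → Euc n :=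
  fun l =>
    if _hle : (l : ℕ) ≤ i then
      if h : (l : ℕ) < k then x ⟨l, h⟩
      else if h0 : 0 < k then x ⟨0, h0⟩ else 0
    else x ⟨(l : ℕ) - 1, by have hl := l.isLt; omega⟩

/-- The Hochschild boundary `b f = ∑ (-1)^i f ∘ D_i`. -/
def hb {n k : ℕ} (f : (Fin (k + 1) → Euc n) → ℝ) : (Fin k → Euc n) → ℝ :=
  fun x => ∑ i ∈ Finset.range (k + 1), (-1 : ℝ) ^ i * f (face k i x)

/-- Degeneracy `σ_i` omitting the `(i+1)`-st entry. -/
def degen {n : ℕ} (i : ℕ) {m : ℕ} (x : Fin (m + 1) → Euc n) : Fin m → Euc n :=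
  fun l =>
    if (l : ℕ) ≤ i then x ⟨l, by have hl := l.isLt; omega⟩
    else x ⟨(l : ℕ) + 1, by have hl := l.isLt; omega⟩

/-- Squared distance of cyclically consecutive entries. -/
def dsq {n m : ℕ} (x : Fin m → Euc n) (j : ℕ) : ℝ :=
  if hm : 0 < m then
    ‖x ⟨j % m, Nat.mod_lt _ hm⟩ - x ⟨(j + 1) % m, Nat.mod_lt _ hm⟩‖ ^ 2
  else 0

/-- Cutoff `Ψ` with `i` factors on `E^m`. -/
def Psi {n : ℕ} (ρ : ℝ → ℝ) (i : ℕ) (t : ℝ) {m : ℕ} (x : Fin m → Euc n) : ℝ :=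
  ∏ j ∈ Finset.range i, ρ (dsq x j / t)

/-- `η_{m,i,t} g = Ψ_{m+1,i,t} · (g ∘ σ_{i-1})`. -/
def eta {n : ℕ} (ρ : ℝ → ℝ) (i : ℕ) (t : ℝ) {m : ℕ} (g : (Fin m → Euc n) → ℝ) :
    (Fin (m + 1) → Euc n) → ℝ :=
  fun x => Psi ρ i t x * g (degen (i - 1) x)

/-- `H_{m,t} = ∑_{i=1}^{m+1} (-1)^{i+1} η_{m,i,t}`. -/
def Hmap {n : ℕ} (ρ : ℝ → ℝ) (t : ℝ) {m : ℕ} (g : (Fin m → Euc n) → ℝ) :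
    (Fin (m + 1) → Euc n) → ℝ :=
  fun x => ∑ i ∈ Finset.Icc 1 m, (-1 : ℝ) ^ (i + 1) * eta ρ i t g x

/-- `K_{m,t} g = ∫_t^1 H_{m,s/2}(∂_s Ψ_{m,s} · g) ds`. -/
def Kmap {n : ℕ} (ρ : ℝ → ℝ) (t : ℝ) {m : ℕ} (g : (Fin m → Euc n) → ℝ) :
    (Fin (m + 1) → Euc n) → ℝ :=
  fun x => ∫ s in t..(1 : ℝ), Hmap ρ (s / 2) (fun y => deriv (fun u => Psi ρ m u y) s * g y) x

/-- Standard basis vector in the `j`-th block, `l`-th coordinate. -/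
def blockVec (n m j : ℕ) (l : Fin n) : Fin m → Euc n :=
  fun j' => if (j' : ℕ) = j then EuclideanSpace.single l 1 else 0

/-- Iterated partial derivative `∂^α_j`. -/
def mpderiv {n m : ℕ} (j : ℕ) (α : Fin n → ℕ) (g : (Fin m → Euc n) → ℝ) :
    (Fin m → Euc n) → ℝ :=
  (List.finRange n).foldr
    (fun l gg => (fun h (x : Fin m → Euc n) => fderiv ℝ h x (blockVec n m j l))^[α l] gg) g


/-- Double-sum cancellation behind a contracting homotopy: the off-diagonal terms cancel in pairs
and the two diagonals telescope. -/
lemma sum_homotopy_telescope (P : ℕ → ℝ) (g : ℕ → ℕ → ℝ) (A : ℕ → ℕ → ℝ) (c : ℝ) (k : ℕ)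
    (hlt : ∀ i j, i + 1 < j → j ≤ k + 1 → A (i + 1) j = P (i + 1) * g (i + 1) (j - 1))
    (heq : ∀ i, i ≤ k → A (i + 1) (i + 1) = P (i + 1) * c)
    (hsucc : ∀ i, i ≤ k → A (i + 1) i = P i * c)
    (hgt : ∀ i j, j < i → i ≤ k → A (i + 1) j = P i * g i j) :
    ∑ j ∈ Finset.range (k + 2), (-1 : ℝ) ^ j *
        ∑ i ∈ Finset.range (k + 1), (-1 : ℝ) ^ i * A (i + 1) j +
      ∑ i ∈ Finset.range k, (-1 : ℝ) ^ i *
        (P (i + 1) * ∑ j ∈ Finset.range (k + 1), (-1 : ℝ) ^ j * g (i + 1) j) =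
      P 0 * c - P (k + 1) * c := by
  induction k with
  | zero =>
    simp [Finset.sum_range_succ, heq 0 le_rfl, hsucc 0 le_rfl]
    ring
  | succ k ih =>
    have ih := ih (fun i j h h' => hlt i j h (by omega)) (fun i h => heq i (by omega))
      (fun i h => hsucc i (by omega)) (fun i j h h' => hgt i j h (by omega))
    have hrow : ∑ i ∈ Finset.range (k + 1), (-1 : ℝ) ^ i * A (i + 1) (k + 2) =
        ∑ i ∈ Finset.range (k + 1), (-1 : ℝ) ^ i * (P (i + 1) * g (i + 1) (k + 1)) :=
      Finset.sum_congr rfl fun i hi => by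
        rw [hlt i (k + 2) (by simp at hi; omega) le_rfl]; rfl
    have hcol : ∑ j ∈ Finset.range (k + 1), (-1 : ℝ) ^ j * ((-1) ^ (k + 1) * A (k + 2) j) =
        (-1) ^ (k + 1) * (P (k + 1) * ∑ j ∈ Finset.range (k + 1), (-1 : ℝ) ^ j * g (k + 1) j) := by
      simp only [Finset.mul_sum]
      refine Finset.sum_congr rfl fun j hj => ?_
      rw [hgt (k + 1) j (by simpa using hj) le_rfl]
      ring
    have hcorner := heq (k + 1) le_rfl
    have hdiag := hsucc (k + 1) le_rfl
    have hsq : ((-1 : ℝ) ^ k) ^ 2 = 1 := by rw [← pow_mul, mul_comm, pow_mul]; simp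
    have hout : ∑ i ∈ Finset.range (k + 1), (-1 : ℝ) ^ i *
          (P (i + 1) * ∑ j ∈ Finset.range (k + 2), (-1 : ℝ) ^ j * g (i + 1) j) =
        ∑ i ∈ Finset.range (k + 1), (-1 : ℝ) ^ i *
          (P (i + 1) * ∑ j ∈ Finset.range (k + 1), (-1 : ℝ) ^ j * g (i + 1) j) +
        (-1) ^ (k + 1) * ∑ i ∈ Finset.range (k + 1), (-1 : ℝ) ^ i * (P (i + 1) * g (i + 1) (k + 1)) := by
      rw [Finset.mul_sum, ← Finset.sum_add_distrib]
      refine Finset.sum_congr rfl fun i _ => ?_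
      rw [Finset.sum_range_succ _ (k + 1)]
      ring
    have hin : ∀ j, ∑ i ∈ Finset.range (k + 2), (-1 : ℝ) ^ i * A (i + 1) j =
        ∑ i ∈ Finset.range (k + 1), (-1 : ℝ) ^ i * A (i + 1) j + (-1) ^ (k + 1) * A (k + 2) j :=
      fun j => Finset.sum_range_succ _ _
    have hleft : ∑ j ∈ Finset.range (k + 3), (-1 : ℝ) ^ j *
          ∑ i ∈ Finset.range (k + 2), (-1 : ℝ) ^ i * A (i + 1) j =
        ∑ j ∈ Finset.range (k + 2), (-1 : ℝ) ^ j *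
          ∑ i ∈ Finset.range (k + 1), (-1 : ℝ) ^ i * A (i + 1) j +
        ∑ j ∈ Finset.range (k + 1), (-1 : ℝ) ^ j * ((-1) ^ (k + 1) * A (k + 2) j) +
        (-1) ^ (k + 1) * ((-1) ^ (k + 1) * A (k + 2) (k + 1)) +
        (-1) ^ (k + 2) * (∑ i ∈ Finset.range (k + 1), (-1 : ℝ) ^ i * A (i + 1) (k + 2) +
          (-1) ^ (k + 1) * A (k + 2) (k + 2)) := by
      simp only [Finset.sum_range_succ _ (k + 2), hin, mul_add, Finset.sum_add_distrib]
      rw [Finset.sum_range_succ (fun j => (-1 : ℝ) ^ j * ((-1) ^ (k + 1) * A (k + 2) j)) (k + 1)]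
      ring
    rw [hleft, hout, hrow, hcol, hcorner, hdiag, Finset.sum_range_succ
      (fun i => (-1 : ℝ) ^ i * (P (i + 1) * ∑ j ∈ Finset.range (k + 1), (-1) ^ j * g (i + 1) j))]
    linear_combination ih + (P (k + 1) * c - P (k + 2) * c) * hsq

lemma Psi_face_of_le {n : ℕ} (ρ : ℝ → ℝ) (t : ℝ) {m i j : ℕ} (x : Fin (m + 1) → Euc n)
    (hij : i ≤ j) (hj : j ≤ m + 1) : Psi ρ i t (face (m + 1) j x) = Psi ρ i t x := by
  refine Finset.prod_congr rfl fun l hl => ?_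
  have hl : l < i := Finset.mem_range.1 hl
  have h1 : l % (m + 1 + 1) = l := Nat.mod_eq_of_lt (by omega)
  have h2 : (l + 1) % (m + 1 + 1) = l + 1 := Nat.mod_eq_of_lt (by omega)
  have h3 : l % (m + 1) = l := Nat.mod_eq_of_lt (by omega)
  have h4 : (l + 1) % (m + 1) = if l + 1 < m + 1 then l + 1 else 0 := by
    split_ifs with h
    · exact Nat.mod_eq_of_lt h
    · rw [show l + 1 = m + 1 by omega, Nat.mod_self]
  simp only [dsq, face, h1, h2, h3, h4]
  split_ifs <;> first | rfl | omega

lemma dsq_face_self {n m j : ℕ} (x : Fin (m + 1) → Euc n) (hj : j ≤ m) :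
    dsq (face (m + 1) j x) j = 0 := by
  have h1 : j % (m + 1 + 1) = j := Nat.mod_eq_of_lt (by omega)
  have h2 : (j + 1) % (m + 1 + 1) = j + 1 := Nat.mod_eq_of_lt (by omega)
  simp only [dsq, face, h1, h2]
  split_ifs <;> first | omega | simp

lemma dsq_face_succ_of_le {n m j l : ℕ} (x : Fin (m + 1) → Euc n) (hjl : j ≤ l) (hl : l ≤ m) :
    dsq (face (m + 1) j x) (l + 1) = dsq x l := by
  have h1 : (l + 1) % (m + 1 + 1) = l + 1 := Nat.mod_eq_of_lt (by omega)
  have h3 : l % (m + 1) = l := Nat.mod_eq_of_lt (by omega)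
  have h2 : (l + 1 + 1) % (m + 1 + 1) = if l < m then l + 2 else 0 := by
    split_ifs with h
    · exact Nat.mod_eq_of_lt (by omega)
    · rw [show l + 1 + 1 = m + 1 + 1 by omega, Nat.mod_self]
  have h4 : (l + 1) % (m + 1) = if l < m then l + 1 else 0 := by
    split_ifs with h
    · exact Nat.mod_eq_of_lt (by omega)
    · rw [show l + 1 = m + 1 by omega, Nat.mod_self]
  simp only [dsq, face, h1, h2, h3, h4]
  split_ifs <;> first | rfl | omega

lemma Psi_face_of_ge {n : ℕ} {ρ : ℝ → ℝ} (hρ : ρ 0 = 1) (t : ℝ) {m i j : ℕ}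
    (x : Fin (m + 1) → Euc n) (hji : j ≤ i) (hi : i ≤ m) :
    Psi ρ (i + 1) t (face (m + 1) j x) = Psi ρ i t x := by
  induction i, hji using Nat.le_induction with
  | base =>
    have h := Psi_face_of_le ρ t x le_rfl (hi.trans m.le_succ)
    simp only [Psi] at h ⊢
    rw [Finset.prod_range_succ, h, dsq_face_self x hi, zero_div, hρ, mul_one]
  | succ i hji ih =>
    have h := ih (by omega)
    simp only [Psi] at h ⊢
    rw [Finset.prod_range_succ, h, dsq_face_succ_of_le x hji (by omega), Finset.prod_range_succ]

lemma degen_face_eq {n m i j : ℕ} (x : Fin (m + 1) → Euc n)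
    (h : i = j ∨ i + 1 = j) : degen i (face (m + 1) j x) = x := by
  funext l
  have hl := l.isLt
  simp only [degen, face]
  split_ifs <;> first | rfl | omega

lemma degen_face_of_lt {n m i j : ℕ} (x : Fin (m + 1) → Euc n)
    (hij : i + 1 < j) (hj : j ≤ m + 1) :
    degen i (face (m + 1) j x) = face m (j - 1) (degen i x) := by
  funext l
  have hl := l.isLt
  simp only [degen, face]
  split_ifs <;> first | rfl | omega | (congr 1; ext; simp; omega)

lemma degen_face_of_gt {n m i j : ℕ} (x : Fin (m + 1) → Euc n)
    (hji : j < i) (hi : i ≤ m) :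
    degen i (face (m + 1) j x) = face m j (degen (i - 1) x) := by
  funext l
  have hl := l.isLt
  simp only [degen, face]
  split_ifs <;> first | rfl | omega | (congr 1; ext; simp; omega)

lemma Hmap_eq_sum_range {n : ℕ} (ρ : ℝ → ℝ) (t : ℝ) {m : ℕ} (g : (Fin m → Euc n) → ℝ)
    (x : Fin (m + 1) → Euc n) :
    Hmap ρ t g x = ∑ i ∈ Finset.range m, (-1 : ℝ) ^ i * (Psi ρ (i + 1) t x * g (degen i x)) := by
  rw [Hmap, ← Finset.Ico_succ_right_eq_Icc, Finset.sum_Ico_eq_sum_range]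
  refine Finset.sum_congr rfl fun i _ => ?_
  rw [add_comm 1 i, eta, Nat.add_sub_cancel]
  ring

theorem stmt14 {n : ℕ} (hn : 1 ≤ n)
    (ρ : ℝ → ℝ) (hρsmooth : ContDiff ℝ (⊤ : ℕ∞) ρ)
    (hρ0 : ∀ r : ℝ, 0 ≤ ρ r) (hρ1 : ∀ r : ℝ, ρ r ≤ 1)
    (hρone : ∀ r : ℝ, r ≤ 1 / 3 → ρ r = 1) (hρzero : ∀ r : ℝ, 1 / 2 < r → ρ r = 0)
    {k : ℕ} (hk : 1 ≤ k) (t : ℝ) (ht : 0 < t)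
    (f : (Fin (k + 1) → Euc n) → ℝ) (x : Fin (k + 1) → Euc n) :
    hb (Hmap ρ t f) x + Hmap ρ t (hb f) x = f x - Psi ρ (k + 1) t x * f x := by
  have hρ : ρ 0 = 1 := hρone 0 (by norm_num)
  have key := sum_homotopy_telescope (fun i => Psi ρ i t x)
    (fun i j => f (face k j (degen (i - 1) x)))
    (fun i j => Psi ρ i t (face (k + 1) j x) * f (degen (i - 1) (face (k + 1) j x))) (f x) k
    (fun i j hij hj => by
      simp only [Nat.add_sub_cancel]
      rw [Psi_face_of_le ρ t x hij.le hj, degen_face_of_lt x hij hj])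
    (fun i hi => by
      simp only [Nat.add_sub_cancel]
      rw [Psi_face_of_le ρ t x le_rfl (by omega), degen_face_eq x (.inr rfl)])
    (fun i hi => by
      simp only [Nat.add_sub_cancel]
      rw [Psi_face_of_ge hρ t x le_rfl hi, degen_face_eq x (.inl rfl)])
    (fun i j hji hi => by
      simp only [Nat.add_sub_cancel]
      rw [Psi_face_of_ge hρ t x hji.le hi, degen_face_of_gt x hji hi])
  simp only [Nat.add_sub_cancel] at key
  have hΨ : Psi ρ 0 t x = 1 := by simp [Psi]
  rw [hΨ, one_mul] at key
  simp only [hb, Hmap_eq_sum_range]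
  exact key
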